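/- arXiv:2502.16232 — 3 statements merged into one kernel-verified Lean document; each statement's English description precedes it below -/
import Mathlib

section
/- Let m, n ∈ ℕ, let P_χ ∈ ℝ^{m×m} and P_γ ∈ ℝ^{n×n} be symmetric positive definite, let E ∈ ℝ^m, F ∈ ℝ^{m×m}, G ∈ ℝ^n, H ∈ ℝ^{n×m}, and set K' := P_χ Hᵀ (H P_χ Hᵀ + P_γ)⁻¹. Then (I_m − K' H) P_χ and P_γ + H P_χ Hᵀ are symmetric positive definite, and for all χ, χ' ∈ ℝ^m and γ ∈ ℝ^n: N_n(γ | G + H χ', P_γ) · N_m(χ' | E + F χ, P_χ) = N_n(γ | G + H E + H F χ, P_γ + H P_χ Hᵀ) · N_m(χ' | E − K'(G + H E) + K' γ + (F − K' H F) χ, (I_m − K' H) P_χ). (This identity shows that the conventional linear Gaussian state-space model, with transition mean E + F χ and observation mean G + H χ', is a special case of the FBF latent model in which the state update is conditioned on the current observation.) -/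
open MeasureTheory Matrix Real

/-- Multivariate Gaussian density `N_d(x | μ, S)`. -/
noncomputable def gaussD {d : ℕ} (S : Matrix (Fin d) (Fin d) ℝ) (μ x : Fin d → ℝ) : ℝ :=
  (2 * Real.pi) ^ (-(d : ℝ) / 2) * S.det ^ (-(1 : ℝ) / 2) *
    Real.exp (-(1 / 2 : ℝ) * ((x - μ) ⬝ᵥ (S⁻¹ *ᵥ (x - μ))))

theorem Matrix.mulVec_dotProduct_eq_dotProduct_transpose_mulVec {ι κ R : Type*} [Fintype ι]
    [Fintype κ] [CommSemiring R] (A : Matrix ι κ R) (x : κ → R) (y : ι → R) :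
    (A *ᵥ x) ⬝ᵥ y = x ⬝ᵥ (Aᵀ *ᵥ y) := by
  rw [dotProduct_mulVec, vecMul_transpose]

/-- Completing the square in the sum of the prior and likelihood quadratic forms. -/
theorem Matrix.quadratic_form_complete_square {ι κ R : Type*} [Fintype ι] [Fintype κ]
    [CommRing R] (H : Matrix κ ι R) (K : Matrix ι κ R)
    (A S : Matrix κ κ R) (B L : Matrix ι ι R) (hA : Aᵀ = A) (hL : Lᵀ = L)
    (hLsum : L = B + Hᵀ * A * H) (hLK : L * K = Hᵀ * A) (hS : A = S + A * H * K)
    (a : κ → R) (b : ι → R) :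
    (a - H *ᵥ b) ⬝ᵥ (A *ᵥ (a - H *ᵥ b)) + b ⬝ᵥ (B *ᵥ b) =
      a ⬝ᵥ (S *ᵥ a) + (b - K *ᵥ a) ⬝ᵥ (L *ᵥ (b - K *ᵥ a)) := by
  have hKL : Kᵀ * L = A * H := by
    simpa [transpose_mul, hA, hL] using congrArg transpose hLK
  have hKLK : Kᵀ * (L * K) = A * H * K := by rw [← Matrix.mul_assoc, hKL]
  have haa : a ⬝ᵥ (A *ᵥ a) = a ⬝ᵥ (S *ᵥ a) + a ⬝ᵥ ((A * H * K) *ᵥ a) := by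
    conv_lhs => rw [hS]
    rw [add_mulVec, dotProduct_add]
  have hbb : b ⬝ᵥ (L *ᵥ b) = b ⬝ᵥ (B *ᵥ b) + b ⬝ᵥ ((Hᵀ * (A * H)) *ᵥ b) := by
    rw [hLsum, add_mulVec, dotProduct_add, Matrix.mul_assoc]
  simp only [mulVec_sub, sub_dotProduct, dotProduct_sub,
    mulVec_dotProduct_eq_dotProduct_transpose_mulVec, mulVec_mulVec]
  rw [hKLK, hKL, hLK, hbb, haa]
  ring

theorem linear_SSM_is_special_case_of_FBF (m n : ℕ)
    (Pχ : Matrix (Fin m) (Fin m) ℝ) (Pγ : Matrix (Fin n) (Fin n) ℝ)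
    (hPχ : Pχ.PosDef) (hPγ : Pγ.PosDef)
    (E : Fin m → ℝ) (F : Matrix (Fin m) (Fin m) ℝ)
    (G : Fin n → ℝ) (H : Matrix (Fin n) (Fin m) ℝ)
    (K' : Matrix (Fin m) (Fin n) ℝ) (hK' : K' = Pχ * Hᵀ * (H * Pχ * Hᵀ + Pγ)⁻¹) :
    ((1 - K' * H) * Pχ).PosDef ∧ (Pγ + H * Pχ * Hᵀ).PosDef ∧
    ∀ (χ χ' : Fin m → ℝ) (γ : Fin n → ℝ),
      gaussD Pγ (G + H *ᵥ χ') γ * gaussD Pχ (E + F *ᵥ χ) χ' =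
        gaussD (Pγ + H * Pχ * Hᵀ) (G + H *ᵥ E + (H * F) *ᵥ χ) γ *
          gaussD ((1 - K' * H) * Pχ)
            (E - K' *ᵥ (G + H *ᵥ E) + K' *ᵥ γ + (F - K' * H * F) *ᵥ χ) χ' := by
  have hS : (Pγ + H * Pχ * Hᵀ).PosDef :=
    hPγ.add_posSemidef (by
      simpa [conjTranspose_eq_transpose_of_trivial] using
        hPχ.posSemidef.mul_mul_conjTranspose_same H)
  rw [add_comm (H * Pχ * Hᵀ) Pγ] at hK'
  have uS := (isUnit_iff_isUnit_det _).mp hS.isUnit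
  have uγ := (isUnit_iff_isUnit_det _).mp hPγ.isUnit
  have uχ := (isUnit_iff_isUnit_det _).mp hPχ.isUnit
  have hΛ : (Pχ⁻¹ + Hᵀ * Pγ⁻¹ * H).PosDef :=
    hPχ.inv.add_posSemidef (by
      simpa [conjTranspose_eq_transpose_of_trivial] using
        hPγ.inv.posSemidef.conjTranspose_mul_mul_same H)
  have hKS : K' * (Pγ + H * Pχ * Hᵀ) = Pχ * Hᵀ := by
    rw [hK', nonsing_inv_mul_cancel_right _ _ uS]
  have hKγ : K' * Pγ = (1 - K' * H) * Pχ * Hᵀ := by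
    rw [Matrix.mul_add] at hKS
    rw [eq_sub_of_add_eq hKS]
    simp only [Matrix.sub_mul, Matrix.one_mul, Matrix.mul_assoc]
  have hK : K' = (1 - K' * H) * Pχ * Hᵀ * Pγ⁻¹ := by
    rw [← hKγ, mul_nonsing_inv_cancel_right _ _ uγ]
  have hMΛ : ((1 - K' * H) * Pχ) * (Pχ⁻¹ + Hᵀ * Pγ⁻¹ * H) = 1 := by
    rw [Matrix.mul_add, mul_nonsing_inv_cancel_right _ _ uχ, ← Matrix.mul_assoc,
      ← Matrix.mul_assoc, ← hK, sub_add_cancel]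
  have hMinv : ((1 - K' * H) * Pχ)⁻¹ = Pχ⁻¹ + Hᵀ * Pγ⁻¹ * H := inv_eq_right_inv hMΛ
  have hM : ((1 - K' * H) * Pχ).PosDef := by
    rw [← posDef_inv_iff, hMinv]
    exact hΛ
  have hγS : (1 - H * K') * (Pγ + H * Pχ * Hᵀ) = Pγ := by
    rw [Matrix.sub_mul, Matrix.one_mul, Matrix.mul_assoc H K', hKS, Matrix.mul_assoc H Pχ,
      add_sub_cancel_right]
  have hdet : Pγ.det * Pχ.det = (Pγ + H * Pχ * Hᵀ).det * ((1 - K' * H) * Pχ).det := by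
    conv_lhs => rw [← hγS]
    rw [det_mul, det_mul, det_one_sub_mul_comm]
    ring
  refine ⟨hM, hS, fun χ χ' γ => ?_⟩
  have hΛK : (Pχ⁻¹ + Hᵀ * Pγ⁻¹ * H) * K' = Hᵀ * Pγ⁻¹ := by
    conv_lhs => rw [hK]
    rw [Matrix.mul_assoc _ Hᵀ, ← Matrix.mul_assoc, mul_eq_one_comm.mp hMΛ, Matrix.one_mul]
  have hSinv : Pγ⁻¹ = (Pγ + H * Pχ * Hᵀ)⁻¹ + Pγ⁻¹ * H * K' := by
    have hγH : Pγ⁻¹ * (1 - H * K') = (Pγ + H * Pχ * Hᵀ)⁻¹ := by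
      refine (inv_eq_left_inv ?_).symm
      rw [Matrix.mul_assoc, hγS, nonsing_inv_mul _ uγ]
    rw [← hγH, Matrix.mul_sub, Matrix.mul_one, Matrix.mul_assoc, sub_add_cancel]
  have hquad := quadratic_form_complete_square H K' Pγ⁻¹ (Pγ + H * Pχ * Hᵀ)⁻¹ Pχ⁻¹
    (Pχ⁻¹ + Hᵀ * Pγ⁻¹ * H) (by simpa using hPγ.inv.isHermitian.eq)
    (by simpa [conjTranspose_eq_transpose_of_trivial] using hΛ.isHermitian.eq) rfl hΛK hSinv
    (γ - (G + H *ᵥ E + (H * F) *ᵥ χ)) (χ' - (E + F *ᵥ χ))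
  have ha : γ - (G + H *ᵥ E + (H * F) *ᵥ χ) - H *ᵥ (χ' - (E + F *ᵥ χ)) =
      γ - (G + H *ᵥ χ') := by
    simp only [mulVec_sub, mulVec_add, mulVec_mulVec]
    abel
  have hb : χ' - (E + F *ᵥ χ) - K' *ᵥ (γ - (G + H *ᵥ E + (H * F) *ᵥ χ)) =
      χ' - (E - K' *ᵥ (G + H *ᵥ E) + K' *ᵥ γ + (F - K' * H * F) *ᵥ χ) := by
    simp only [mulVec_sub, mulVec_add, mulVec_mulVec, sub_mulVec, Matrix.mul_assoc]
    abel
  rw [ha, hb, ← hMinv] at hquad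
  have hpow := congrArg (fun t : ℝ => t ^ (-(1 : ℝ) / 2)) hdet
  simp only [Real.mul_rpow hPγ.det_pos.le hPχ.det_pos.le,
    Real.mul_rpow hS.det_pos.le hM.det_pos.le] at hpow
  have hexp := congrArg (fun t : ℝ => Real.exp (-(1 / 2 : ℝ) * t)) hquad
  simp only [mul_add, Real.exp_add] at hexp
  unfold gaussD
  rw [mul_mul_mul_comm, mul_mul_mul_comm (_ * _) (Real.exp _), mul_mul_mul_comm (_ ^ _),
    mul_mul_mul_comm (_ ^ _) (_ ^ _) (_ ^ (-(m : ℝ) / 2)), hpow, hexp]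
end

section
/- Let m, n, K ∈ ℕ, let γ₁, …, γ_K ∈ ℝ^n, let A : ℝ^n → ℝ^m, B : ℝ^n → ℝ^{m×m}, and Q_χ : ℝ^n → ℝ^{m×m} be functions such that Q_χ(γ) is symmetric positive definite for every γ, let C ∈ ℝ^n, D ∈ ℝ^{n×m}, let Q_γ ∈ ℝ^{n×n} and Σ₀ ∈ ℝ^{m×m} be symmetric positive definite, and let μ₀ ∈ ℝ^m. Define recursively, for k = 1, …, K: S_k := D Σ_{k−1} Dᵀ + Q_γ, μ'_{k−1} := μ_{k−1} + Σ_{k−1} Dᵀ S_k⁻¹ (γ_k − C − D μ_{k−1}), Σ'_{k−1} := Σ_{k−1} − Σ_{k−1} Dᵀ S_k⁻¹ D Σ_{k−1}, μ_k := A(γ_k) + B(γ_k) μ'_{k−1}, Σ_k := B(γ_k) Σ'_{k−1} B(γ_k)ᵀ + Q_χ(γ_k). Also define the unnormalized latent filtering densities g₀(χ) := N_m(χ | μ₀, Σ₀) and g_k(χ) := ∫_{ℝ^m} N_m(χ | A(γ_k) + B(γ_k) χ', Q_χ(γ_k)) · N_n(γ_k | C + D χ', Q_γ) · g_{k−1}(χ')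 dχ'. Then for every k = 0, 1, …, K, the matrix Σ_k is symmetric positive definite and g_k(χ) = (∏_{j=1}^{k} N_n(γ_j | C + D μ_{j−1}, S_j)) · N_m(χ | μ_k, Σ_k) for all χ ∈ ℝ^m. (This is the assertion that the latent filtering distribution of the flow-based Bayesian filter remains Gaussian at every time step, with mean and covariance given by the stated Kalman-type recursion.) -/
open MeasureTheory Matrix Real

lemma integral_comp_mulVec {d : ℕ} {M : Matrix (Fin d) (Fin d) ℝ} (hM : M.det ≠ 0)
    {f : (Fin d → ℝ) → ℝ} (hf : Continuous f) :
    ∫ x, f (M *ᵥ x) = |M.det|⁻¹ * ∫ x, f x := by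
  have h := integral_map (μ := volume) (Continuous.matrix_mulVec (continuous_const (y := M))
    continuous_id).aemeasurable hf.aestronglyMeasurable
  have hmap := Real.map_matrix_volume_pi_eq_smul_volume_pi hM
  change Measure.map (fun x => M *ᵥ x) volume = _ at hmap
  simp only [id] at h
  rw [← h, hmap, integral_smul_measure, ENNReal.toReal_ofReal (abs_nonneg _), abs_inv, smul_eq_mul]

lemma integral_exp_neg_half_dotProduct_self (d : ℕ) :
    ∫ x : Fin d → ℝ, Real.exp (-(1 / 2 : ℝ) * (x ⬝ᵥ x)) = √(2 * Real.pi) ^ d := by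
  have h := integral_fintype_prod_volume_eq_pow (ι := Fin d)
    (fun t : ℝ => Real.exp (-(1 / 2 : ℝ) * t ^ 2))
  simp only [integral_gaussian, Fintype.card_fin, ← Real.exp_sum, ← Finset.mul_sum] at h
  simp only [dotProduct, ← sq]
  rw [h]
  congr 2
  ring

open scoped MatrixOrder in
lemma Matrix.PosDef.exists_transpose_mul_self {d : ℕ} {M : Matrix (Fin d) (Fin d) ℝ}
    (hM : M.PosDef) : ∃ L : Matrix (Fin d) (Fin d) ℝ, M = Lᵀ * L := by
  obtain ⟨L, hL⟩ := CStarAlgebra.nonneg_iff_eq_star_mul_self.mp hM.posSemidef.nonneg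
  exact ⟨L, by simpa [star_eq_conjTranspose] using hL⟩

lemma integral_gaussD {d : ℕ} {S : Matrix (Fin d) (Fin d) ℝ} (hS : S.PosDef) (μ : Fin d → ℝ) :
    ∫ x, gaussD S μ x = 1 := by
  obtain ⟨L, hL⟩ := hS.inv.exists_transpose_mul_self
  have hS0 := hS.det_pos
  have hdet : S.det⁻¹ = L.det ^ 2 := by
    have := congrArg det hL
    rwa [det_mul, det_transpose, det_nonsing_inv, Ring.inverse_eq_inv', ← sq] at this
  have hL0 : L.det ≠ 0 := by
    intro h
    rw [h] at hdet
    simp [hS0.ne'] at hdet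
  have hquad : ∀ x : Fin d → ℝ, x ⬝ᵥ (S⁻¹ *ᵥ x) = (L *ᵥ x) ⬝ᵥ (L *ᵥ x) := by
    intro x
    rw [hL, ← mulVec_mulVec, dotProduct_mulVec, vecMul_transpose]
  simp only [gaussD]
  rw [integral_const_mul,
    integral_sub_right_eq_self (fun x => Real.exp (-(1 / 2 : ℝ) * (x ⬝ᵥ (S⁻¹ *ᵥ x)))) μ]
  simp only [hquad]
  rw [integral_comp_mulVec (f := fun y => Real.exp (-(1 / 2 : ℝ) * (y ⬝ᵥ y))) hL0
    (by unfold dotProduct; fun_prop), integral_exp_neg_half_dotProduct_self]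
  have hpi : 0 < 2 * Real.pi := by positivity
  have h1 : (2 * Real.pi) ^ (-(d : ℝ) / 2) * √(2 * Real.pi) ^ d = 1 := by
    rw [Real.sqrt_eq_rpow, ← Real.rpow_natCast, ← Real.rpow_mul hpi.le, ← Real.rpow_add hpi]
    ring_nf
    simp
  have h2 : S.det ^ (-(1 : ℝ) / 2) = |L.det| := by
    rw [neg_div, Real.rpow_neg hS0.le, ← Real.inv_rpow hS0.le, ← Real.sqrt_eq_rpow, hdet,
      Real.sqrt_sq_eq_abs]
  have h3 : |L.det| ≠ 0 := abs_ne_zero.mpr hL0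
  rw [h2]
  calc _ = ((2 * Real.pi) ^ (-(d : ℝ) / 2) * √(2 * Real.pi) ^ d) * (|L.det| * |L.det|⁻¹) := by ring
    _ = 1 := by rw [h1, mul_inv_cancel₀ h3, mul_one]

section Conditioning

variable {m n : ℕ} {P : Matrix (Fin m) (Fin m) ℝ} {R : Matrix (Fin n) (Fin n) ℝ}
  (D : Matrix (Fin n) (Fin m) ℝ)

lemma innovation_posDef (hP : P.PosDef) (hR : R.PosDef) : (D * P * Dᵀ + R).PosDef := by
  have h := hP.posSemidef.mul_mul_conjTranspose_same D
  rw [conjTranspose_eq_transpose_of_trivial] at h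
  exact PosDef.posSemidef_add h hR

lemma precision_posDef (hP : P.PosDef) (hR : R.PosDef) : (P⁻¹ + Dᵀ * R⁻¹ * D).PosDef := by
  have h := hR.inv.posSemidef.conjTranspose_mul_mul_same D
  rw [conjTranspose_eq_transpose_of_trivial] at h
  exact hP.inv.add_posSemidef h

lemma precision_mul_gain (hP : P.PosDef) (hR : R.PosDef) :
    (P⁻¹ + Dᵀ * R⁻¹ * D) * (P * Dᵀ * (D * P * Dᵀ + R)⁻¹) = Dᵀ * R⁻¹ := by
  have hPu := (isUnit_iff_isUnit_det _).mp hP.isUnit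
  have hRu := (isUnit_iff_isUnit_det _).mp hR.isUnit
  have hSu := (isUnit_iff_isUnit_det _).mp (innovation_posDef D hP hR).isUnit
  have h : (P⁻¹ + Dᵀ * R⁻¹ * D) * (P * Dᵀ) = Dᵀ * R⁻¹ * (D * P * Dᵀ + R) := by
    rw [Matrix.add_mul, Matrix.mul_add, ← Matrix.mul_assoc P⁻¹, nonsing_inv_mul _ hPu,
      Matrix.one_mul, Matrix.mul_assoc Dᵀ R⁻¹ R, nonsing_inv_mul _ hRu, Matrix.mul_one, add_comm]
    simp only [Matrix.mul_assoc]
  rw [← Matrix.mul_assoc, h, mul_nonsing_inv_cancel_right _ _ hSu]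

lemma precision_mul_posterior (hP : P.PosDef) (hR : R.PosDef) :
    (P⁻¹ + Dᵀ * R⁻¹ * D) * (P - P * Dᵀ * (D * P * Dᵀ + R)⁻¹ * D * P) = 1 := by
  have hPu := (isUnit_iff_isUnit_det _).mp hP.isUnit
  rw [Matrix.mul_sub, Matrix.mul_assoc _ D P, ← Matrix.mul_assoc _ _ (D * P),
    precision_mul_gain D hP hR, Matrix.add_mul, nonsing_inv_mul _ hPu, Matrix.mul_assoc _ D P,
    add_sub_cancel_right]

lemma posterior_eq_inv (hP : P.PosDef) (hR : R.PosDef) :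
    P - P * Dᵀ * (D * P * Dᵀ + R)⁻¹ * D * P = (P⁻¹ + Dᵀ * R⁻¹ * D)⁻¹ :=
  (inv_eq_right_inv (precision_mul_posterior D hP hR)).symm

lemma posterior_posDef (hP : P.PosDef) (hR : R.PosDef) :
    (P - P * Dᵀ * (D * P * Dᵀ + R)⁻¹ * D * P).PosDef :=
  posterior_eq_inv D hP hR ▸ (precision_posDef D hP hR).inv

lemma det_mul_det_eq_innovation_mul_posterior (hP : P.PosDef) (hR : R.PosDef) :
    R.det * P.det =
      (D * P * Dᵀ + R).det * (P - P * Dᵀ * (D * P * Dᵀ + R)⁻¹ * D * P).det := by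
  have hPu := (isUnit_iff_isUnit_det _).mp hP.isUnit
  have hRu := (isUnit_iff_isUnit_det _).mp hR.isUnit
  have hM : (P⁻¹ + Dᵀ * R⁻¹ * D) * P = 1 + Dᵀ * (R⁻¹ * D * P) := by
    rw [Matrix.add_mul, nonsing_inv_mul _ hPu]
    simp only [Matrix.mul_assoc]
  have hS : R * (1 + R⁻¹ * D * P * Dᵀ) = D * P * Dᵀ + R := by
    rw [Matrix.mul_add, Matrix.mul_one, add_comm]
    simp only [Matrix.mul_assoc]
    rw [mul_nonsing_inv_cancel_left _ _ hRu]
  have h1 := congrArg det hM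
  have h2 := congrArg det hS
  have h3 := congrArg det (precision_mul_posterior D hP hR)
  rw [det_mul, det_one_add_mul_comm] at h1
  rw [det_mul] at h2 h3
  rw [det_one] at h3
  rw [← h2, ← h1]
  linear_combination (-(R.det * P.det)) * h3

lemma quadratic_form_innovation_posterior (hP : P.PosDef) (hR : R.PosDef)
    (u : Fin m → ℝ) (v : Fin n → ℝ) :
    (v - D *ᵥ u) ⬝ᵥ (R⁻¹ *ᵥ (v - D *ᵥ u)) + u ⬝ᵥ (P⁻¹ *ᵥ u) =
      v ⬝ᵥ ((D * P * Dᵀ + R)⁻¹ *ᵥ v) +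
        (u - (P * Dᵀ * (D * P * Dᵀ + R)⁻¹) *ᵥ v) ⬝ᵥ
          ((P - P * Dᵀ * (D * P * Dᵀ + R)⁻¹ * D * P)⁻¹ *ᵥ
            (u - (P * Dᵀ * (D * P * Dᵀ + R)⁻¹) *ᵥ v)) := by
  have hMP := precision_posDef D hP hR
  have hSP := innovation_posDef D hP hR
  have hMu := (isUnit_iff_isUnit_det _).mp hMP.isUnit
  have hRu := (isUnit_iff_isUnit_det _).mp hR.isUnit
  have hSu := (isUnit_iff_isUnit_det _).mp hSP.isUnit
  have hPt : Pᵀ = P := hP.isHermitian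
  have hRt : R⁻¹ᵀ = R⁻¹ := hR.inv.isHermitian
  have hSt : (D * P * Dᵀ + R)⁻¹ᵀ = (D * P * Dᵀ + R)⁻¹ := hSP.inv.isHermitian
  have hMt : (P⁻¹ + Dᵀ * R⁻¹ * D)ᵀ = P⁻¹ + Dᵀ * R⁻¹ * D := hMP.isHermitian
  have hMK := precision_mul_gain D hP hR
  have hKMK : (P * Dᵀ * (D * P * Dᵀ + R)⁻¹)ᵀ * (Dᵀ * R⁻¹) =
      R⁻¹ - (D * P * Dᵀ + R)⁻¹ := by
    rw [transpose_mul, transpose_mul, hSt, hPt, transpose_transpose]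
    calc _ = (D * P * Dᵀ + R)⁻¹ * ((D * P * Dᵀ + R) - R) * R⁻¹ := by
          rw [add_sub_cancel_right]; simp only [Matrix.mul_assoc]
      _ = _ := by
          rw [Matrix.mul_sub, nonsing_inv_mul _ hSu, Matrix.sub_mul, Matrix.one_mul,
            mul_nonsing_inv_cancel_right _ _ hRu]
  rw [posterior_eq_inv D hP hR, nonsing_inv_nonsing_inv _ hMu]
  generalize P * Dᵀ * (D * P * Dᵀ + R)⁻¹ = G at *
  have hpair : ∀ {a b : ℕ} (X : Matrix (Fin a) (Fin b) ℝ) (x : Fin b → ℝ) (y : Fin a → ℝ),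
      (X *ᵥ x) ⬝ᵥ y = x ⬝ᵥ (Xᵀ *ᵥ y) := by
    intro a b X x y
    rw [dotProduct_mulVec, vecMul_transpose]
  have hGM : Gᵀ * (P⁻¹ + Dᵀ * R⁻¹ * D) = R⁻¹ * D := by
    have := congrArg transpose hMK
    rwa [transpose_mul, hMt, transpose_mul, transpose_transpose, hRt] at this
  have e1 : (G *ᵥ v) ⬝ᵥ ((P⁻¹ + Dᵀ * R⁻¹ * D) *ᵥ (G *ᵥ v)) =
      v ⬝ᵥ (R⁻¹ *ᵥ v) - v ⬝ᵥ ((D * P * Dᵀ + R)⁻¹ *ᵥ v) := by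
    rw [mulVec_mulVec, hMK, hpair, mulVec_mulVec, hKMK, sub_mulVec, dotProduct_sub]
  have e2 : (G *ᵥ v) ⬝ᵥ ((P⁻¹ + Dᵀ * R⁻¹ * D) *ᵥ u) = v ⬝ᵥ (R⁻¹ *ᵥ (D *ᵥ u)) := by
    rw [hpair, mulVec_mulVec, hGM, mulVec_mulVec]
  have e3 : u ⬝ᵥ ((P⁻¹ + Dᵀ * R⁻¹ * D) *ᵥ (G *ᵥ v)) = (D *ᵥ u) ⬝ᵥ (R⁻¹ *ᵥ v) := by
    rw [hpair, mulVec_mulVec, hMK, mulVec_mulVec]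
  have e4 : u ⬝ᵥ ((P⁻¹ + Dᵀ * R⁻¹ * D) *ᵥ u) =
      u ⬝ᵥ (P⁻¹ *ᵥ u) + (D *ᵥ u) ⬝ᵥ (R⁻¹ *ᵥ (D *ᵥ u)) := by
    rw [add_mulVec, dotProduct_add, hpair]
    simp only [mulVec_mulVec, Matrix.mul_assoc]
  simp only [mulVec_sub, sub_dotProduct, dotProduct_sub]
  rw [e1, e2, e3, e4]
  ring

/-- Bayes' rule for the linear Gaussian model. -/
lemma gaussD_mul_gaussD (hP : P.PosDef) (hR : R.PosDef) (C y : Fin n → ℝ) (μ x : Fin m → ℝ) :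
    gaussD R (C + D *ᵥ x) y * gaussD P μ x =
      gaussD (D * P * Dᵀ + R) (C + D *ᵥ μ) y *
        gaussD (P - P * Dᵀ * (D * P * Dᵀ + R)⁻¹ * D * P)
          (μ + (P * Dᵀ * (D * P * Dᵀ + R)⁻¹) *ᵥ (y - C - D *ᵥ μ)) x := by
  have hq := quadratic_form_innovation_posterior D hP hR (x - μ) (y - C - D *ᵥ μ)
  have h1 : y - C - D *ᵥ μ - D *ᵥ (x - μ) = y - (C + D *ᵥ x) := by
    rw [mulVec_sub]; abel
  have hd := congrArg (· ^ (-(1 : ℝ) / 2)) (det_mul_det_eq_innovation_mul_posterior D hP hR)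
  rw [Real.mul_rpow hR.det_pos.le hP.det_pos.le, Real.mul_rpow
    (innovation_posDef D hP hR).det_pos.le (posterior_posDef D hP hR).det_pos.le] at hd
  rw [h1, sub_sub x] at hq
  unfold gaussD
  rw [← sub_sub y C (D *ᵥ μ)]
  rw [mul_mul_mul_comm, mul_mul_mul_comm (_ * _) (Real.exp _) (_ * _) (Real.exp _), ← Real.exp_add,
    ← Real.exp_add, ← mul_add, ← mul_add, hq, mul_mul_mul_comm, hd,
    mul_mul_mul_comm (_ ^ _) (_ ^ _) (_ ^ _) (_ ^ _)]

/-- The marginal of the linear Gaussian model. -/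
lemma integral_gaussD_mul_gaussD (hP : P.PosDef) (hR : R.PosDef)
    (C y : Fin n → ℝ) (μ : Fin m → ℝ) :
    ∫ x, gaussD R (C + D *ᵥ x) y * gaussD P μ x = gaussD (D * P * Dᵀ + R) (C + D *ᵥ μ) y := by
  simp only [gaussD_mul_gaussD D hP hR]
  rw [integral_const_mul, integral_gaussD (posterior_posDef D hP hR), mul_one]

end Conditioning

/-- The latent filtering distribution of the flow-based Bayesian filter remains Gaussian
at every time step, with mean and covariance given by the Kalman-type recursion. -/
theorem FBF_latent_filter_gaussian (m n K : ℕ)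
    (γ : ℕ → Fin n → ℝ)
    (A : (Fin n → ℝ) → (Fin m → ℝ))
    (B : (Fin n → ℝ) → Matrix (Fin m) (Fin m) ℝ)
    (Qχ : (Fin n → ℝ) → Matrix (Fin m) (Fin m) ℝ)
    (hQχ : ∀ y, (Qχ y).PosDef)
    (C : Fin n → ℝ) (D : Matrix (Fin n) (Fin m) ℝ)
    (Qγ : Matrix (Fin n) (Fin n) ℝ) (hQγ : Qγ.PosDef)
    (Sig0 : Matrix (Fin m) (Fin m) ℝ) (hSig0 : Sig0.PosDef)
    (μ₀ : Fin m → ℝ)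
    (μ : ℕ → Fin m → ℝ) (Sig : ℕ → Matrix (Fin m) (Fin m) ℝ)
    (g : ℕ → (Fin m → ℝ) → ℝ)
    (hμ0 : μ 0 = μ₀) (hSig0' : Sig 0 = Sig0)
    (hμ : ∀ k < K, μ (k + 1) =
      A (γ (k + 1)) + (B (γ (k + 1))) *ᵥ
        (μ k + (Sig k * Dᵀ * (D * Sig k * Dᵀ + Qγ)⁻¹) *ᵥ (γ (k + 1) - C - D *ᵥ μ k)))
    (hSig : ∀ k < K, Sig (k + 1) =
      B (γ (k + 1)) *
          (Sig k - Sig k * Dᵀ * (D * Sig k * Dᵀ + Qγ)⁻¹ * D * Sig k) *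
          (B (γ (k + 1)))ᵀ + Qχ (γ (k + 1)))
    (hg0 : ∀ χ, g 0 χ = gaussD Sig0 μ₀ χ)
    (hg : ∀ k < K, ∀ χ : Fin m → ℝ, g (k + 1) χ =
      ∫ χ' : Fin m → ℝ,
        gaussD (Qχ (γ (k + 1))) (A (γ (k + 1)) + B (γ (k + 1)) *ᵥ χ') χ *
          gaussD Qγ (C + D *ᵥ χ') (γ (k + 1)) * g k χ') :
    ∀ k ≤ K, (Sig k).PosDef ∧
      ∀ χ : Fin m → ℝ, g k χ =
        (∏ j ∈ Finset.range k,
            gaussD (D * Sig j * Dᵀ + Qγ) (C + D *ᵥ μ j) (γ (j + 1))) *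
          gaussD (Sig k) (μ k) χ := by
  intro k
  induction k with
  | zero =>
    intro _
    refine ⟨hSig0' ▸ hSig0, fun χ => ?_⟩
    simp [hg0, hSig0', hμ0]
  | succ k ih =>
    intro hk
    obtain ⟨hP, hgk⟩ := ih (Nat.le_of_succ_le hk)
    have hpost := posterior_posDef D hP hQγ
    refine ⟨hSig k hk ▸ innovation_posDef _ hpost (hQχ _), fun χ => ?_⟩
    rw [hg k hk, hμ k hk, hSig k hk, Finset.prod_range_succ,
      ← integral_gaussD_mul_gaussD _ hpost (hQχ _), ← integral_const_mul]
    refine integral_congr_ae (ae_of_all _ fun x => ?_)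
    have hb := gaussD_mul_gaussD D hP hQγ C (γ (k + 1)) (μ k) x
    simp only [hgk]
    linear_combination (gaussD (Qχ (γ (k + 1))) (A (γ (k + 1)) + B (γ (k + 1)) *ᵥ x) χ *
      ∏ j ∈ Finset.range k, gaussD (D * Sig j * Dᵀ + Qγ) (C + D *ᵥ μ j) (γ (j + 1))) * hb
end

section
/- Let m, n ∈ ℕ, let Σ, P_χ ∈ ℝ^{m×m} and P_γ ∈ ℝ^{n×n} be symmetric positive definite, let E, μ ∈ ℝ^m, F ∈ ℝ^{m×m}, G, γ ∈ ℝ^n, H ∈ ℝ^{n×m}. Define P⁻ := F Σ Fᵀ + P_χ, S := H P⁻ Hᵀ + P_γ, K := P⁻ Hᵀ S⁻¹, μ⁺ := E + F μ + K (γ − H F μ − H E − G), and Σ⁺ := (I_m − K H) P⁻. Then Σ⁺ is symmetric positive definite and there exists a constant c > 0 (independent of χ₁) such that for all χ₁ ∈ ℝ^m: N_n(γ | G + H χ₁, P_γ) · ∫_{ℝ^m} N_m(χ₁ | E + F χ, P_χ) · N_m(χ | μ, Σ) dχ = c · N_m(χ₁ | μ⁺, Σ⁺). (This is the one-step Kalman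 filter update for the linear Gaussian latent state-space model: given a Gaussian prior N(μ, Σ) at the previous time step, the filtering distribution at the next step is Gaussian with the stated mean and covariance.) -/
open MeasureTheory Matrix Real

theorem Matrix.PosDef.exists_eq_transpose_mul_self {d : ℕ} {A : Matrix (Fin d) (Fin d) ℝ}
    (hA : A.PosDef) : ∃ B : Matrix (Fin d) (Fin d) ℝ, A = Bᵀ * B ∧ B.det ≠ 0 := by
  open scoped MatrixOrder in
  obtain ⟨B, hB⟩ := CStarAlgebra.nonneg_iff_eq_star_mul_self.mp hA.posSemidef.nonneg
  rw [star_eq_conjTranspose, conjTranspose_eq_transpose_of_trivial] at hB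
  refine ⟨B, hB, fun h => hA.det_pos.ne' ?_⟩
  rw [hB, det_mul, h, mul_zero]

theorem integrable_exp_neg_half_dotProduct_self (d : ℕ) :
    Integrable fun x : Fin d → ℝ => Real.exp (-(1 / 2 : ℝ) * (x ⬝ᵥ x)) := by
  have h := Integrable.fintype_prod (ι := Fin d)
    (f := fun _ (t : ℝ) => Real.exp (-(1 / 2 : ℝ) * t ^ 2)) (μ := fun _ => volume)
    fun _ => integrable_exp_neg_mul_sq (by norm_num)
  convert! h using 2 with x
  rw [← Real.exp_sum, ← Finset.mul_sum]
  simp only [dotProduct, pow_two]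

theorem Matrix.PosDef.integrable_exp_neg_half_quadratic {d : ℕ} {A : Matrix (Fin d) (Fin d) ℝ}
    (hA : A.PosDef) :
    Integrable fun x : Fin d → ℝ => Real.exp (-(1 / 2 : ℝ) * (x ⬝ᵥ (A *ᵥ x))) := by
  obtain ⟨B, rfl, hB⟩ := hA.exists_eq_transpose_mul_self
  have h : Integrable (fun x : Fin d → ℝ => Real.exp (-(1 / 2 : ℝ) * (x ⬝ᵥ x)))
      (Measure.map (toLin' B) volume) := by
    rw [Real.map_matrix_volume_pi_eq_smul_volume_pi hB]
    exact (integrable_exp_neg_half_dotProduct_self d).smul_measure ENNReal.ofReal_ne_top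
  refine (h.comp_aemeasurable
    (LinearMap.continuous_on_pi (toLin' B)).measurable.aemeasurable).congr (.of_forall fun x => ?_)
  simp only [Function.comp_apply, toLin'_apply, ← mulVec_mulVec, dotProduct_transpose_mulVec]

theorem Matrix.PosDef.quadratic_inv_add_mulVec {d : ℕ} {M : Matrix (Fin d) (Fin d) ℝ} (hM : M.PosDef)
    (x t : Fin d → ℝ) :
    (x + M *ᵥ t) ⬝ᵥ (M⁻¹ *ᵥ (x + M *ᵥ t)) =
      x ⬝ᵥ (M⁻¹ *ᵥ x) + 2 * (x ⬝ᵥ t) + t ⬝ᵥ (M *ᵥ t) := by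
  have hdet : IsUnit M.det := (isUnit_iff_isUnit_det M).mp hM.isUnit
  have hsymm : M⁻¹ᵀ = M⁻¹ := by
    simpa [conjTranspose_eq_transpose_of_trivial] using hM.inv.isHermitian.eq
  have h₁ : M⁻¹ *ᵥ (M *ᵥ t) = t := by rw [mulVec_mulVec, nonsing_inv_mul _ hdet, one_mulVec]
  have h₂ : (M *ᵥ t) ⬝ᵥ (M⁻¹ *ᵥ x) = x ⬝ᵥ t := by
    rw [← dotProduct_transpose_mulVec, hsymm, h₁]
  rw [mulVec_add, h₁, add_dotProduct, dotProduct_add, dotProduct_add, h₂,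
    dotProduct_comm (M *ᵥ t) t]
  ring

section Conditioning

variable {m n : ℕ} {P : Matrix (Fin m) (Fin m) ℝ} {R : Matrix (Fin n) (Fin n) ℝ}

theorem Matrix.PosDef.conj_add (hP : P.PosDef) (hR : R.PosDef) (H : Matrix (Fin n) (Fin m) ℝ) :
    (H * P * Hᵀ + R).PosDef := by
  have h := hP.posSemidef.mul_mul_conjTranspose_same H
  rw [conjTranspose_eq_transpose_of_trivial] at h
  exact PosDef.posSemidef_add h hR

theorem Matrix.PosDef.information_posDef (hP : P.PosDef) (hR : R.PosDef)
    (H : Matrix (Fin n) (Fin m) ℝ) : (P⁻¹ + Hᵀ * R⁻¹ * H).PosDef := by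
  have h := hR.inv.posSemidef.conjTranspose_mul_mul_same H
  rw [conjTranspose_eq_transpose_of_trivial] at h
  exact hP.inv.add_posSemidef h

theorem Matrix.PosDef.inv_information (hP : P.PosDef) (hR : R.PosDef) (H : Matrix (Fin n) (Fin m) ℝ) :
    (P⁻¹ + Hᵀ * R⁻¹ * H)⁻¹ = (1 - P * Hᵀ * (H * P * Hᵀ + R)⁻¹ * H) * P := by
  have hPd : IsUnit P.det := (isUnit_iff_isUnit_det P).mp hP.isUnit
  have hRd : IsUnit R.det := (isUnit_iff_isUnit_det R).mp hR.isUnit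
  set S := H * P * Hᵀ + R with hS
  have hSd : IsUnit S.det := (isUnit_iff_isUnit_det S).mp (hP.conj_add hR H).isUnit
  set K := P * Hᵀ * S⁻¹ with hK
  have hKS : K * S = P * Hᵀ := by rw [hK, Matrix.mul_assoc, nonsing_inv_mul _ hSd, Matrix.mul_one]
  have hKR : (1 - K * H) * P * Hᵀ = K * R := by
    have : K * R = K * S - K * (H * P * Hᵀ) := by
      rw [hS, Matrix.mul_add, add_sub_cancel_left]
    rw [this, hKS]
    simp only [Matrix.sub_mul, Matrix.one_mul, Matrix.mul_assoc]
  refine inv_eq_left_inv ?_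
  calc (1 - K * H) * P * (P⁻¹ + Hᵀ * R⁻¹ * H)
      = (1 - K * H) * (P * P⁻¹) + ((1 - K * H) * P * Hᵀ) * R⁻¹ * H := by
        simp only [Matrix.mul_add, Matrix.mul_assoc]
    _ = (1 - K * H) + K * (R * R⁻¹) * H := by
        rw [hKR, mul_nonsing_inv _ hPd, Matrix.mul_one, Matrix.mul_assoc K]
    _ = 1 := by rw [mul_nonsing_inv _ hRd, Matrix.mul_one, sub_add_cancel]

theorem Matrix.PosDef.quadratic_completion (hP : P.PosDef) (hR : R.PosDef)
    (H : Matrix (Fin n) (Fin m) ℝ) (u : Fin m → ℝ) (v : Fin n → ℝ) :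
    (v - H *ᵥ u) ⬝ᵥ (R⁻¹ *ᵥ (v - H *ᵥ u)) + u ⬝ᵥ (P⁻¹ *ᵥ u) =
      (u - (P * Hᵀ * (H * P * Hᵀ + R)⁻¹) *ᵥ v) ⬝ᵥ ((P⁻¹ + Hᵀ * R⁻¹ * H) *ᵥ
        (u - (P * Hᵀ * (H * P * Hᵀ + R)⁻¹) *ᵥ v)) +
      v ⬝ᵥ ((H * P * Hᵀ + R)⁻¹ *ᵥ v) := by
  set S := H * P * Hᵀ + R with hS
  have hSd : IsUnit S.det := (isUnit_iff_isUnit_det S).mp (hP.conj_add hR H).isUnit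
  obtain ⟨s, rfl⟩ : ∃ s, v = S *ᵥ s :=
    ⟨S⁻¹ *ᵥ v, by rw [mulVec_mulVec, mul_nonsing_inv _ hSd, one_mulVec]⟩
  have hs : S⁻¹ *ᵥ (S *ᵥ s) = s := by rw [mulVec_mulVec, nonsing_inv_mul _ hSd, one_mulVec]
  obtain ⟨a, rfl⟩ : ∃ a, u = a + P *ᵥ (Hᵀ *ᵥ s) := ⟨u - P *ᵥ (Hᵀ *ᵥ s), by simp⟩
  have hres : S *ᵥ s - H *ᵥ (a + P *ᵥ (Hᵀ *ᵥ s)) = -(H *ᵥ a) + R *ᵥ s := by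
    rw [hS, add_mulVec, mulVec_add]
    simp only [← mulVec_mulVec]
    abel
  rw [hres, hR.quadratic_inv_add_mulVec, hP.quadratic_inv_add_mulVec, ← mulVec_mulVec _ (P * Hᵀ),
    hs, ← mulVec_mulVec s P, add_sub_cancel_right, dotProduct_comm (S *ᵥ s), hS]
  simp only [add_mulVec, dotProduct_add, ← mulVec_mulVec, dotProduct_transpose_mulVec,
    mulVec_neg, neg_dotProduct, dotProduct_neg]
  rw [dotProduct_comm (H *ᵥ a) s, dotProduct_comm (R⁻¹ *ᵥ (H *ᵥ a)),
    dotProduct_comm (Hᵀ *ᵥ s), dotProduct_transpose_mulVec]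
  ring

end Conditioning

theorem Matrix.PosDef.gaussD_const_pos {d : ℕ} {M : Matrix (Fin d) (Fin d) ℝ} (hM : M.PosDef) :
    0 < (2 * Real.pi) ^ (-(d : ℝ) / 2) * M.det ^ (-(1 : ℝ) / 2) :=
  mul_pos (Real.rpow_pos_of_pos (by positivity) _) (Real.rpow_pos_of_pos hM.det_pos _)

theorem Matrix.PosDef.exists_gaussD_mul_gaussD {m n : ℕ} {P : Matrix (Fin m) (Fin m) ℝ}
    {R : Matrix (Fin n) (Fin n) ℝ} (hP : P.PosDef) (hR : R.PosDef)
    (H : Matrix (Fin n) (Fin m) ℝ) :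
    ∃ c : ℝ, 0 < c ∧ ∀ (b y : Fin n → ℝ) (μ x : Fin m → ℝ),
      gaussD R (b + H *ᵥ x) y * gaussD P μ x =
        c * gaussD (H * P * Hᵀ + R) (b + H *ᵥ μ) y *
          gaussD ((1 - P * Hᵀ * (H * P * Hᵀ + R)⁻¹ * H) * P)
            (μ + (P * Hᵀ * (H * P * Hᵀ + R)⁻¹) *ᵥ (y - (b + H *ᵥ μ))) x := by
  have hA := hP.information_posDef hR H
  have h₁ := hR.gaussD_const_pos
  have h₂ := hP.gaussD_const_pos
  have h₃ := (hP.conj_add hR H).gaussD_const_pos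
  have h₄ := hA.inv.gaussD_const_pos
  rw [← hP.inv_information hR H]
  refine ⟨_, div_pos (mul_pos h₁ h₂) (mul_pos h₃ h₄), fun b y μ x => ?_⟩
  have hq := hP.quadratic_completion hR H (x - μ) (y - (b + H *ᵥ μ))
  have hy : y - (b + H *ᵥ μ) - H *ᵥ (x - μ) = y - (b + H *ᵥ x) := by
    rw [mulVec_sub]; abel
  rw [hy, sub_sub] at hq
  simp only [gaussD]
  rw [nonsing_inv_nonsing_inv _ ((isUnit_iff_isUnit_det _).mp hA.isUnit)]
  rw [mul_mul_mul_comm, ← Real.exp_add, ← mul_add, hq, mul_add, Real.exp_add]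
  generalize (2 * Real.pi) ^ (-(n : ℝ) / 2) * R.det ^ (-(1 : ℝ) / 2) = k₁ at *
  generalize (2 * Real.pi) ^ (-(m : ℝ) / 2) * P.det ^ (-(1 : ℝ) / 2) = k₂ at *
  generalize (2 * Real.pi) ^ (-(n : ℝ) / 2) * (H * P * Hᵀ + R).det ^ (-(1 : ℝ) / 2) = k₃ at *
  generalize (2 * Real.pi) ^ (-(m : ℝ) / 2) *
    (P⁻¹ + Hᵀ * R⁻¹ * H)⁻¹.det ^ (-(1 : ℝ) / 2) = k₄ at *
  field_simp

theorem Matrix.PosDef.exists_integral_gaussD {d : ℕ} {M : Matrix (Fin d) (Fin d) ℝ} (hM : M.PosDef) :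
    ∃ c : ℝ, 0 < c ∧ ∀ μ : Fin d → ℝ, ∫ x : Fin d → ℝ, gaussD M μ x = c := by
  refine ⟨_, mul_pos hM.gaussD_const_pos
    (integral_exp_pos hM.inv.integrable_exp_neg_half_quadratic), fun μ => ?_⟩
  simp only [gaussD]
  rw [integral_const_mul, integral_sub_right_eq_self
    (fun x : Fin d → ℝ => Real.exp (-(1 / 2 : ℝ) * (x ⬝ᵥ (M⁻¹ *ᵥ x)))) μ]

theorem kalman_one_step_update (m n : ℕ)
    (Sig Pχ : Matrix (Fin m) (Fin m) ℝ) (Pγ : Matrix (Fin n) (Fin n) ℝ)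
    (hSig : Sig.PosDef) (hPχ : Pχ.PosDef) (hPγ : Pγ.PosDef)
    (E μ : Fin m → ℝ) (F : Matrix (Fin m) (Fin m) ℝ)
    (G γ : Fin n → ℝ) (H : Matrix (Fin n) (Fin m) ℝ)
    (Pminus : Matrix (Fin m) (Fin m) ℝ) (hPminus : Pminus = F * Sig * Fᵀ + Pχ)
    (S : Matrix (Fin n) (Fin n) ℝ) (hS : S = H * Pminus * Hᵀ + Pγ)
    (K : Matrix (Fin m) (Fin n) ℝ) (hK : K = Pminus * Hᵀ * S⁻¹)
    (μplus : Fin m → ℝ)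
    (hμplus : μplus = E + F *ᵥ μ + K *ᵥ (γ - H *ᵥ (F *ᵥ μ) - H *ᵥ E - G))
    (Sigplus : Matrix (Fin m) (Fin m) ℝ) (hSigplus : Sigplus = (1 - K * H) * Pminus) :
    Sigplus.PosDef ∧
    ∃ c : ℝ, 0 < c ∧ ∀ χ₁ : Fin m → ℝ,
      gaussD Pγ (G + H *ᵥ χ₁) γ *
          ∫ χ : Fin m → ℝ, gaussD Pχ (E + F *ᵥ χ) χ₁ * gaussD Sig μ χ =
        c * gaussD Sigplus μplus χ₁ := by
  subst hPminus hS hK hμplus hSigplus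
  have hPm := hSig.conj_add hPχ F
  refine ⟨hPm.inv_information hPγ H ▸ (hPm.information_posDef hPγ H).inv, ?_⟩
  obtain ⟨c₁, hc₁, h₁⟩ := hSig.exists_gaussD_mul_gaussD hPχ F
  obtain ⟨c₂, hc₂, h₂⟩ := hPm.exists_gaussD_mul_gaussD hPγ H
  obtain ⟨c₃, hc₃, h₃⟩ := Matrix.PosDef.exists_integral_gaussD
    (hSig.inv_information hPχ F ▸ (hSig.information_posDef hPχ F).inv)
  have h₄ : 0 < gaussD (H * (F * Sig * Fᵀ + Pχ) * Hᵀ + Pγ) (G + H *ᵥ (E + F *ᵥ μ)) γ :=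
    mul_pos (hPm.conj_add hPγ H).gaussD_const_pos (Real.exp_pos _)
  refine ⟨_, mul_pos (mul_pos (mul_pos hc₁ hc₃) hc₂) h₄, fun χ₁ => ?_⟩
  have hγ : γ - H *ᵥ (F *ᵥ μ) - H *ᵥ E - G = γ - (G + H *ᵥ (E + F *ᵥ μ)) := by
    rw [mulVec_add]; abel
  simp only [h₁, integral_const_mul, h₃, hγ]
  linear_combination (c₁ * c₃) * h₂ G γ (E + F *ᵥ μ) χ₁
end
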